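/- Let $k$ be a field, $A = k[x_1, \dots, x_n]$ (or any smooth $k$-algebra with free module of differentials), and $E$ a finitely generated $A$-module equipped with operators $\nabla_i : E \to E$ for $1 \leq i \leq n$ satisfying $\nabla_i(a e) = \frac{\partial a}{\partial x_i} e + a \nabla_i(e)$. Assume $k$ has characteristic zero. Then the Fitting ideals of $E$ are invariant under all partial derivatives $\partial/\partial x_i$, and consequently each $\mathrm{Fitt}_r(E)$ is either $0$ or the unit ideal; hence $E$ is a projective (locally free) $A$-module when $A$ is in addition a polynomial ring over $k$ and $E$ is finitely presented with $\mathrm{Spec} A$ connected — more precisely, $E$ is locally free. -/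

import Mathlib

/-- The `r`-th Fitting ideal of a module `M`: for a presentation
`(Fin n → R) →ₗ M` (surjective), it is generated by the `(n - r) × (n - r)`
minors of matrices whose rows are relations (elements of the kernel). -/
def fittingIdeal (R : Type*) [CommRing R] (M : Type*) [AddCommGroup M] [Module R M]
    (r : ℕ) : Ideal R :=
  ⨆ (n : ℕ) (π : (Fin n → R) →ₗ[R] M) (_ : Function.Surjective π),
    Ideal.span { d : R | ∃ (m : ℕ) (_ : m + r = n) (v : Fin m → (Fin n → R))
      (g : Fin m → Fin n), (∀ i, π (v i) = 0) ∧
      d = Matrix.det (Matrix.of fun i j : Fin m => v i (g j)) }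

namespace Stmt15

open Matrix

lemma derivation_prod {R A ι : Type*} [CommRing R] [CommRing A] [Algebra R A] [DecidableEq ι]
    (D : Derivation R A A) (s : Finset ι) (f : ι → A) :
    D (∏ i ∈ s, f i) = ∑ c ∈ s, ∏ i ∈ s, (if i = c then D (f i) else f i) := by
  induction s using Finset.induction_on with
  | empty => simp
  | insert a s ha ih =>
    rw [Finset.prod_insert ha, Finset.sum_insert ha, Finset.prod_insert ha, D.leibniz, ih]
    have h1 : ∏ i ∈ s, (if i = a then D (f i) else f i) = ∏ i ∈ s, f i :=
      Finset.prod_congr rfl fun i hi => if_neg (by rintro rfl; exact ha hi)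
    have h2 : ∑ c ∈ s, ∏ i ∈ insert a s, (if i = c then D (f i) else f i)
        = f a * ∑ c ∈ s, ∏ i ∈ s, (if i = c then D (f i) else f i) := by
      rw [Finset.mul_sum]
      refine Finset.sum_congr rfl fun c hc => ?_
      rw [Finset.prod_insert ha, if_neg (by rintro rfl; exact ha hc)]
    rw [h1, h2]
    simp only [smul_eq_mul, if_true]
    ring

lemma trace_adj_col {A ι : Type*} [CommRing A] [Fintype ι] [DecidableEq ι]
    (M N : Matrix ι ι A) :
    trace (adjugate M * N) = ∑ c, (M.updateCol c (fun i => N i c)).det := by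
  refine Finset.sum_congr rfl fun c _ => ?_
  rw [← cramer_apply, cramer_eq_adjugate_mulVec]
  rfl

lemma trace_adj_row {A ι : Type*} [CommRing A] [Fintype ι] [DecidableEq ι]
    (M N : Matrix ι ι A) :
    trace (adjugate M * N) = ∑ c, (M.updateRow c (N c)).det := by
  rw [trace_mul_comm]
  refine Finset.sum_congr rfl fun c _ => ?_
  rw [← cramer_transpose_apply, cramer_eq_adjugate_mulVec, ← adjugate_transpose]
  simp only [diag_apply, mul_apply, mulVec, dotProduct, transpose_apply]
  exact Finset.sum_congr rfl fun _ _ => mul_comm _ _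

lemma derivation_det {R A ι : Type*} [CommRing R] [CommRing A] [Algebra R A]
    [Fintype ι] [DecidableEq ι] (D : Derivation R A A) (M : Matrix ι ι A) :
    D M.det = trace (adjugate M * M.map D) := by
  rw [trace_adj_col]
  simp only [det_apply, map_sum]
  rw [Finset.sum_comm]
  refine Finset.sum_congr rfl fun σ _ => ?_
  rw [← Finset.smul_sum, Units.smul_def, Units.smul_def, map_zsmul, derivation_prod]
  congr 1
  refine Finset.sum_congr rfl fun c _ => Finset.prod_congr rfl fun i _ => ?_
  rw [updateCol_apply]
  split_ifs with h
  · subst h; rfl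
  · rfl

/-- The generating set of minors for one presentation. -/
def minors {R : Type*} [CommRing R] {M : Type*} [AddCommGroup M] [Module R M]
    (r : ℕ) {n : ℕ} (π : (Fin n → R) →ₗ[R] M) : Set R :=
  { d : R | ∃ (m : ℕ) (_ : m + r = n) (v : Fin m → (Fin n → R))
      (g : Fin m → Fin n), (∀ i, π (v i) = 0) ∧
      d = Matrix.det (Matrix.of fun i j : Fin m => v i (g j)) }

lemma minors_le {R : Type*} [CommRing R] {M : Type*} [AddCommGroup M] [Module R M]
    (r : ℕ) {n : ℕ} (π : (Fin n → R) →ₗ[R] M) (hπ : Function.Surjective π) :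
    Ideal.span (minors r π) ≤ fittingIdeal R M r :=
  le_iSup_of_le n (le_iSup_of_le π (le_iSup_of_le hπ le_rfl))

lemma fitting_le {R : Type*} [CommRing R] {M : Type*} [AddCommGroup M] [Module R M]
    (r : ℕ) (J : Ideal R)
    (h : ∀ (n : ℕ) (π : (Fin n → R) →ₗ[R] M), Function.Surjective π → minors r π ⊆ J) :
    fittingIdeal R M r ≤ J :=
  iSup_le fun n => iSup_le fun π => iSup_le fun hπ => Ideal.span_le.2 (h n π hπ)

lemma apply_eq_sum {R : Type*} [CommRing R] {M : Type*} [AddCommGroup M] [Module R M]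
    {n : ℕ} (π : (Fin n → R) →ₗ[R] M) (v : Fin n → R) :
    π v = ∑ j, v j • π (Pi.single j 1) := by
  conv_lhs => rw [pi_eq_sum_univ' v]
  simp

lemma deriv_minor {R A M : Type*} [CommRing R] [CommRing A] [Algebra R A]
    [AddCommGroup M] [Module A M] (D : Derivation R A A) (nabla : M →+ M)
    (hL : ∀ (a : A) (e : M), nabla (a • e) = D a • e + a • nabla e)
    (r : ℕ) {n : ℕ} (π : (Fin n → A) →ₗ[A] M) (hπ : Function.Surjective π)
    (d : A) (hd : d ∈ minors r π) : D d ∈ Ideal.span (minors r π) := by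
  obtain ⟨m, hm, v, g, hv, rfl⟩ := hd
  choose Γ hΓ using fun j : Fin n => hπ (nabla (π (Pi.single j 1)))
  -- the corrected derivative of a relation is a relation
  set w : (Fin n → A) → (Fin n → A) := fun u => fun l => ∑ j, u j * Γ j l with hw
  have hker : ∀ u, π u = 0 → π ((fun l => D (u l)) + w u) = 0 := by
    intro u hu
    have h0 := congrArg nabla hu
    rw [map_zero, apply_eq_sum π u, map_sum] at h0
    have hwu : w u = ∑ j, u j • Γ j := by
      ext l; simp [hw]
    rw [map_add, hwu, map_sum, apply_eq_sum π (fun l => D (u l)), ← Finset.sum_add_distrib, ← h0]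
    refine Finset.sum_congr rfl fun j _ => ?_
    rw [hL, map_smul, hΓ]
  set V : Matrix (Fin m) (Fin m) A := Matrix.of fun i j => v i (g j) with hV
  have hdec : V.map D = (Matrix.of fun i j => ((fun l => D (v i l)) + w (v i)) (g j))
      - Matrix.of fun i j => w (v i) (g j) := by
    ext i j; simp [hV]
  rw [derivation_det, hdec, Matrix.mul_sub, trace_sub, trace_adj_row, trace_adj_col]
  refine Ideal.sub_mem _ (Ideal.sum_mem _ fun c _ => ?_) (Ideal.sum_mem _ fun c _ => ?_)
  · refine Ideal.subset_span ⟨m, hm, Function.update v c ((fun l => D (v c l)) + w (v c)), g, ?_, ?_⟩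
    · intro i
      by_cases h : i = c
      · subst h; rw [Function.update_self]; exact hker _ (hv _)
      · rw [Function.update_of_ne h]; exact hv i
    · congr 1
      ext i j
      by_cases h : i = c
      · subst h; simp
      · simp [updateRow_apply, h, hV]
  · have hcol : (fun i => (Matrix.of fun i j => w (v i) (g j)) i c)
        = ∑ l, Γ l (g c) • (fun i => v i l) := by
      ext i; simp [hw, mul_comm]
    rw [hcol, ← cramer_apply, map_sum, Finset.sum_apply]
    refine Ideal.sum_mem _ fun l _ => ?_
    rw [map_smul, Pi.smul_apply, smul_eq_mul, cramer_apply]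
    refine Ideal.mul_mem_left _ _ (Ideal.subset_span ⟨m, hm, v, Function.update g c l, hv, ?_⟩)
    congr 1
    ext i j
    by_cases h : j = c
    · subst h; simp
    · simp [updateCol_apply, h, hV]

lemma deriv_span {R A : Type*} [CommRing R] [CommRing A] [Algebra R A] (D : Derivation R A A)
    (S : Set A) (J : Ideal A) (hS : S ⊆ J) (h : ∀ s ∈ S, D s ∈ J) :
    ∀ x ∈ Ideal.span S, D x ∈ J := by
  intro x hx
  induction hx using Submodule.span_induction with
  | mem x hx => exact h x hx
  | zero => simp
  | add x y _ _ hx hy => rw [map_add]; exact J.add_mem hx hy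
  | smul a x hx' hx =>
    rw [smul_eq_mul, D.leibniz, smul_eq_mul, smul_eq_mul]
    exact J.add_mem (J.mul_mem_left _ hx) (J.mul_mem_right _ (Ideal.span_le.2 hS hx'))

lemma fitting_invariant {R A M : Type*} [CommRing R] [CommRing A] [Algebra R A]
    [AddCommGroup M] [Module A M] (D : Derivation R A A) (nabla : M →+ M)
    (hL : ∀ (a : A) (e : M), nabla (a • e) = D a • e + a • nabla e) (r : ℕ) :
    ∀ x ∈ fittingIdeal A M r, D x ∈ fittingIdeal A M r := by
  intro x hx
  have key : fittingIdeal A M r = Ideal.span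
      {d | ∃ (n : ℕ) (π : (Fin n → A) →ₗ[A] M), Function.Surjective π ∧ d ∈ minors r π} := by
    apply le_antisymm
    · exact fitting_le r _ fun n π hπ d hd => Ideal.subset_span ⟨n, π, hπ, hd⟩
    · rw [Ideal.span_le]
      rintro d ⟨n, π, hπ, hd⟩
      exact minors_le r π hπ (Ideal.subset_span hd)
  have hx' := hx
  rw [key] at hx'
  refine deriv_span D _ _ ?_ ?_ x hx'
  · rintro d ⟨n, π, hπ, hd⟩
    exact minors_le r π hπ (Ideal.subset_span hd)
  · rintro d ⟨n, π, hπ, hd⟩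
    exact minors_le r π hπ (deriv_minor D nabla hL r π hπ d hd)

lemma ideal_trivial {k : Type*} [Field k] [CharZero k] {n : ℕ}
    (I : Ideal (MvPolynomial (Fin n) k))
    (hI : ∀ i, ∀ x ∈ I, MvPolynomial.pderiv i x ∈ I) : I = ⊥ ∨ I = ⊤ := by
  have main : ∀ (N : ℕ) (p : MvPolynomial (Fin n) k), p.totalDegree ≤ N → p ∈ I → p ≠ 0 →
      I = ⊤ := by
    intro N
    induction N with
    | zero =>
      intro p hp hpI hp0
      have h := MvPolynomial.totalDegree_eq_zero_iff_eq_C.1 (Nat.le_zero.1 hp)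
      have hc : p.coeff 0 ≠ 0 := by
        intro h0; rw [h0, map_zero] at h; exact hp0 h
      refine Ideal.eq_top_of_isUnit_mem I hpI ?_
      rw [h]
      exact (isUnit_iff_ne_zero.2 hc).map MvPolynomial.C
    | succ N ih =>
      intro p hp hpI hp0
      by_cases h : p.totalDegree ≤ N
      · exact ih p h hpI hp0
      have hpos : ∃ s ∈ p.support, s ≠ 0 := by
        by_contra! hcon
        apply h
        have : p.totalDegree = 0 := by
          rw [MvPolynomial.totalDegree, ← Nat.le_zero]
          refine Finset.sup_le fun s hs => ?_
          rw [hcon s hs]; simp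
        omega
      obtain ⟨s, hs, hs0⟩ := hpos
      obtain ⟨i, hi⟩ : ∃ i, s i ≠ 0 := by
        by_contra! hcon
        exact hs0 (Finsupp.ext hcon)
      have hle : Finsupp.single i 1 ≤ s := by
        rw [Finsupp.single_le_iff]; omega
      refine ih (MvPolynomial.pderiv i p) ?_ (hI i p hpI) ?_
      · rw [MvPolynomial.totalDegree]
        refine Finset.sup_le fun t ht => ?_
        rw [MvPolynomial.mem_support_iff, MvPolynomial.coeff_pderiv] at ht
        have ht' : t + Finsupp.single i 1 ∈ p.support := by
          rw [MvPolynomial.mem_support_iff]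
          intro h0; rw [h0] at ht; simp at ht
        have := MvPolynomial.le_totalDegree ht'
        rw [Finsupp.sum_add_index' (by simp) (by simp), Finsupp.sum_single_index rfl] at this
        omega
      · intro h0
        have := congrArg (MvPolynomial.coeff (s - Finsupp.single i 1)) h0
        rw [MvPolynomial.coeff_pderiv, tsub_add_cancel_of_le hle, MvPolynomial.coeff_zero] at this
        rcases mul_eq_zero.1 this with h1 | h1
        · exact MvPolynomial.mem_support_iff.1 hs h1
        · exact Nat.cast_add_one_ne_zero _ h1
  by_cases h : I = ⊥
  · exact Or.inl h
  · obtain ⟨p, hp, hp0⟩ := Submodule.exists_mem_ne_zero_of_ne_bot h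
    exact Or.inr (main _ p le_rfl hp hp0)

/-- Bordered determinant. -/
lemma bordered {A : Type*} [CommRing A] [IsDomain A] {n m : ℕ} (v : Fin m → Fin n → A)
    (g : Fin m → Fin n) (w : Fin n → A) (l : Fin n)
    (hd : (Matrix.of fun i j : Fin m => v i (g j)).det ≠ 0)
    (h0 : (Matrix.of fun i j : Fin (m + 1) =>
      (Fin.snoc v w : Fin (m + 1) → Fin n → A) i
        ((Fin.snoc g l : Fin (m + 1) → Fin n) j)).det = 0) :
    (Matrix.of fun i j : Fin m => v i (g j)).det * w l
      = ∑ i, ((fun j => w (g j)) ᵥ* adjugate (Matrix.of fun i j : Fin m => v i (g j))) i * v i l := by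
  set M := Matrix.of fun i j : Fin m => v i (g j) with hM
  set c : Matrix (Fin m) (Fin 1) A := Matrix.of fun i _ => v i l with hc
  set u : Matrix (Fin 1) (Fin m) A := Matrix.of fun _ j => w (g j) with hu
  set x : Matrix (Fin 1) (Fin 1) A := Matrix.of fun _ _ => w l with hx
  have hB : (fromBlocks M c u x).det = 0 := by
    rw [← h0, ← det_submatrix_equiv_self finSumFinEquiv]
    congr 1
    ext i j
    rcases i with i | i <;> rcases j with j | j <;>
      simp [hM, hc, hu, hx, Fin.snoc]
  have hmul : fromBlocks M c u x * fromBlocks 1 (-(adjugate M * c)) 0 (M.det • 1)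
      = fromBlocks M 0 u (M.det • x - u * adjugate M * c) := by
    rw [fromBlocks_multiply]
    congr 1
    · simp
    · rw [Matrix.mul_neg, ← Matrix.mul_assoc, mul_adjugate]; simp
    · simp
    · rw [Matrix.mul_neg, ← Matrix.mul_assoc]; simp [sub_eq_neg_add]
  have h2 := congrArg det hmul
  rw [det_mul, hB, zero_mul, det_fromBlocks_zero₁₂] at h2
  have h3 := (mul_eq_zero.1 h2.symm).resolve_left hd
  rw [det_fin_one, Matrix.sub_apply, sub_eq_zero] at h3
  simpa [hx, hc, hu, mul_apply, vecMul, dotProduct] using h3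

lemma projective_of_fitting {A M : Type*} [CommRing A] [IsDomain A]
    [AddCommGroup M] [Module A M] [Module.Finite A M]
    (H : ∀ r, fittingIdeal A M r = ⊥ ∨ fittingIdeal A M r = ⊤) : Module.Projective A M := by
  classical
  obtain ⟨N, p, hp⟩ := Module.Finite.exists_fin' A M
  have hex : ∃ r, fittingIdeal A M r = ⊤ := by
    refine ⟨N, (Ideal.eq_top_iff_one _).2 (minors_le N p hp (Ideal.subset_span ?_))⟩
    exact ⟨0, by simp, Fin.elim0, Fin.elim0, fun i => i.elim0, by simp⟩
  set r := Nat.find hex with hr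
  have hr1 : fittingIdeal A M r = ⊤ := Nat.find_spec hex
  -- vanishing of the next minors
  have hvan : ∀ (n : ℕ) (π : (Fin n → A) →ₗ[A] M), Function.Surjective π → ∀ m, m + r = n →
      ∀ (v : Fin (m + 1) → Fin n → A) (g : Fin (m + 1) → Fin n), (∀ i, π (v i) = 0) →
      (Matrix.of fun i j => v i (g j)).det = 0 := by
    intro n π hπ m hm v g hv
    rcases Nat.eq_zero_or_pos r with h | h
    · have hn : ¬ Function.Injective g := by
        intro hg
        have := Fintype.card_le_of_injective g hg
        simp at this
        omega
      rw [Function.Injective] at hn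
      push Not at hn
      obtain ⟨a, b, hab, hne⟩ := hn
      exact det_zero_of_column_eq hne fun i => by simp [hab]
    · have hb : fittingIdeal A M (r - 1) = ⊥ :=
        (H (r - 1)).resolve_right (Nat.find_min hex (by omega))
      have : (Matrix.of fun i j => v i (g j)).det ∈ fittingIdeal A M (r - 1) :=
        minors_le _ π hπ (Ideal.subset_span ⟨m + 1, by omega, v, g, hv, rfl⟩)
      rw [hb] at this
      exact this
  let J : Ideal A :=
    { carrier := {a | ∃ s : M →ₗ[A] (Fin N → A), p ∘ₗ s = a • LinearMap.id}
      zero_mem' := ⟨0, by simp⟩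
      add_mem' := by
        rintro a b ⟨s, hs⟩ ⟨t, ht⟩
        exact ⟨s + t, by rw [LinearMap.comp_add, hs, ht, add_smul]⟩
      smul_mem' := by
        rintro a b ⟨s, hs⟩
        exact ⟨a • s, by rw [LinearMap.comp_smul, hs, smul_eq_mul, mul_smul]⟩ }
  have hJ : fittingIdeal A M r ≤ J := by
    refine fitting_le r J fun n π hπ d hd => ?_
    by_cases hd0 : d = 0
    · rw [hd0]; exact J.zero_mem
    obtain ⟨m, hm, v, g, hv, rfl⟩ := hd
    set V := Matrix.of fun i j : Fin m => v i (g j) with hV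
    let ρ : (Fin n → A) →ₗ[A] (Fin n → A) :=
      ∑ i, ((LinearMap.proj i ∘ₗ Matrix.vecMulLinear (adjugate V) ∘ₗ
        LinearMap.funLeft A A g).smulRight (v i))
    have hρ : ∀ w, ρ w = ∑ i, ((fun j => w (g j)) ᵥ* adjugate V) i • v i := by
      intro w
      simp [ρ, LinearMap.sum_apply]
      rfl
    have hker : LinearMap.ker π ≤ LinearMap.ker (V.det • LinearMap.id - ρ) := by
      intro w hw
      rw [LinearMap.mem_ker] at hw ⊢
      rw [LinearMap.sub_apply, sub_eq_zero, hρ]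
      ext l
      have := bordered v g w l hd0 (hvan n π hπ m hm _ _ ?_)
      · simpa using this
      · intro i
        refine Fin.lastCases ?_ (fun i => ?_) i
        · simpa using hw
        · simpa using hv i
    obtain ⟨q, hq⟩ := Module.projective_lifting_property p π hp
    let s : M →ₗ[A] (Fin n → A) :=
      (LinearMap.ker π).liftQ (V.det • LinearMap.id - ρ) hker ∘ₗ
        (π.quotKerEquivOfSurjective hπ).symm.toLinearMap
    have hs : ∀ w, s (π w) = V.det • w - ρ w := by
      intro w
      have : (π.quotKerEquivOfSurjective hπ).symm (π w) = Submodule.Quotient.mk w := by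
        rw [LinearEquiv.symm_apply_eq]; rfl
      simp only [s, LinearMap.comp_apply, LinearEquiv.coe_coe, this]
      rfl
    refine ⟨q ∘ₗ s, ?_⟩
    rw [← LinearMap.comp_assoc, hq]
    ext e
    obtain ⟨w, rfl⟩ := hπ e
    rw [LinearMap.comp_apply, hs, map_sub, hρ, map_sum]
    simp [hv]
  rw [hr1] at hJ
  obtain ⟨s, hs⟩ : (1 : A) ∈ J := hJ trivial
  rw [one_smul] at hs
  exact Module.Projective.of_split s p hs

end Stmt15

/-- a finitely presented module over `k[x₁,…,xₙ]` (char 0) with a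
connection along all coordinate derivations has Fitting ideals invariant under
all `∂/∂xᵢ`; consequently each Fitting ideal is `0` or `(1)`, and the module is
projective (locally free). -/
theorem stmt_15 (k : Type*) [Field k] [CharZero k] (n : ℕ)
    (E : Type*) [AddCommGroup E] [Module (MvPolynomial (Fin n) k) E]
    [Module.Finite (MvPolynomial (Fin n) k) E]
    [Module.FinitePresentation (MvPolynomial (Fin n) k) E]
    (nabla : Fin n → (E →+ E))
    (hL : ∀ (i : Fin n) (a : MvPolynomial (Fin n) k) (e : E),
      nabla i (a • e) = MvPolynomial.pderiv i a • e + a • nabla i e) :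
    (∀ (r : ℕ) (i : Fin n), ∀ x ∈ fittingIdeal (MvPolynomial (Fin n) k) E r,
        MvPolynomial.pderiv i x ∈ fittingIdeal (MvPolynomial (Fin n) k) E r) ∧
    (∀ r : ℕ, fittingIdeal (MvPolynomial (Fin n) k) E r = ⊥ ∨
        fittingIdeal (MvPolynomial (Fin n) k) E r = ⊤) ∧
    Module.Projective (MvPolynomial (Fin n) k) E := by
  have h1 : ∀ (r : ℕ) (i : Fin n), ∀ x ∈ fittingIdeal (MvPolynomial (Fin n) k) E r,
      MvPolynomial.pderiv i x ∈ fittingIdeal (MvPolynomial (Fin n) k) E r :=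
    fun r i => Stmt15.fitting_invariant (MvPolynomial.pderiv i) (nabla i) (hL i) r
  have h2 : ∀ r : ℕ, fittingIdeal (MvPolynomial (Fin n) k) E r = ⊥ ∨
      fittingIdeal (MvPolynomial (Fin n) k) E r = ⊤ :=
    fun r => Stmt15.ideal_trivial _ (h1 r)
  exact ⟨h1, h2, Stmt15.projective_of_fitting h2⟩
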